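/- Let p be a prime and t, k positive integers with t ≥ 1. Suppose f : {0,1}^n → {0,1} is a symmetric Boolean function whose base-p period equals p^t (i.e., f is p^t-periodic but not p^{t−1}-periodic) and n ≥ (k−1)·φ(p^t) + p^t − 1. Then deg_{p^k}(f) ≥ (k−2)·φ(p^t) + p^t. -/

import Mathlib

/-- Hamming weight of a Boolean input. -/
def wt {n : ℕ} (x : Fin n → Bool) : ℕ :=
  (Finset.univ.filter fun i => x i = true).card

/-- Coefficient of the monomial `∏_{i ∈ S} x_i` in the unique multilinear polynomial over
`ℤ_m` representing the Boolean function `f`, obtained by Möbius inversion. -/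
def modCoeff (m n : ℕ) (f : (Fin n → Bool) → Bool) (S : Finset (Fin n)) : ZMod m :=
  ∑ T ∈ S.powerset, (-1 : ZMod m) ^ (S.card - T.card) * (if f (fun i => decide (i ∈ T)) then 1 else 0)

/-- The modulo-`m` degree of a Boolean function: the total degree of the unique multilinear
polynomial over `ℤ_m` representing it. -/
def modDeg (m n : ℕ) (f : (Fin n → Bool) → Bool) : ℕ :=
  ((Finset.univ : Finset (Finset (Fin n))).filter fun S => modCoeff m n f S ≠ 0).sup Finset.card

/-- A Boolean function is symmetric if its value depends only on the Hamming weight. -/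
def SymmetricBF {n : ℕ} (f : (Fin n → Bool) → Bool) : Prop :=
  ∀ x y, wt x = wt y → f x = f y

/-- A Boolean function is non-trivial if it is not constant. -/
def NontrivialBF {n : ℕ} (f : (Fin n → Bool) → Bool) : Prop :=
  ∃ x y, f x ≠ f y

/-- A symmetric Boolean function is `ℓ`-periodic if its univariate version takes equal values
on arguments that agree modulo `ℓ`. -/
def PeriodicBF {n : ℕ} (ℓ : ℕ) (f : (Fin n → Bool) → Bool) : Prop :=
  ∀ x y : Fin n → Bool, wt x % ℓ = wt y % ℓ → f x = f y

/-- A Boolean function is non-degenerate if every coordinate is sensitive on some input. -/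
def NondegenerateBF {n : ℕ} (f : (Fin n → Bool) → Bool) : Prop :=
  ∀ i : Fin n, ∃ x, f x ≠ f (Function.update x i (!x i))

open Polynomial

section PolynomialIdentities

variable {p : ℕ}

/-- `(X + 1) ^ (p ^ u) - 1` is congruent to `X ^ (p ^ u)` modulo `p`. -/
theorem exists_shift_pow_sub_one_eq (hp : p.Prime) (u : ℕ) :
    ∃ g : ℤ[X], (X + 1) ^ p ^ u - 1 = X ^ p ^ u + (p : ℤ[X]) * g := by
  obtain ⟨g, hg⟩ := exists_add_pow_prime_pow_eq hp (X : ℤ[X]) 1 u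
  refine ⟨X * g, ?_⟩
  rw [hg, one_pow]
  ring

/-- The `p ^ (u + 1)`-th cyclotomic polynomial evaluated at `X + 1`. -/
noncomputable def shiftedCyclotomic (p u : ℕ) : ℤ[X] :=
  ∑ i ∈ Finset.range p, ((X + 1) ^ p ^ u) ^ i

theorem shiftedCyclotomic_mul (p u : ℕ) :
    shiftedCyclotomic p u * ((X + 1) ^ p ^ u - 1) = (X + 1) ^ p ^ (u + 1) - 1 := by
  rw [shiftedCyclotomic, geom_sum_mul, ← pow_mul, ← pow_succ]

theorem monic_shift_pow (m : ℕ) : ((X + 1 : ℤ[X]) ^ m).Monic := by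
  simpa using (monic_X_add_C (1 : ℤ)).pow m

theorem natDegree_shift_pow (m : ℕ) : ((X + 1 : ℤ[X]) ^ m).natDegree = m := by
  simpa using natDegree_pow_X_add_C (R := ℤ) m 1

theorem monic_shiftedCyclotomic (hp : p.Prime) (u : ℕ) : (shiftedCyclotomic p u).Monic := by
  refine Monic.geom_sum (monic_shift_pow _) ?_ hp.ne_zero
  rw [natDegree_shift_pow]
  exact pow_pos hp.pos u

theorem natDegree_shiftedCyclotomic (hp : p.Prime) (u : ℕ) :
    (shiftedCyclotomic p u).natDegree = p ^ u * (p - 1) := by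
  have hr : 0 < p ^ u := pow_pos hp.pos u
  have hdeg (m : ℕ) : ((X + 1 : ℤ[X]) ^ m - 1).natDegree = m := by
    rw [← C_1, natDegree_sub_C, C_1, natDegree_shift_pow]
  have hne : (X + 1 : ℤ[X]) ^ p ^ u - 1 ≠ 0 := by
    intro h
    have := hdeg (p ^ u)
    rw [h, natDegree_zero] at this
    omega
  have h := congrArg natDegree (shiftedCyclotomic_mul p u)
  rw [natDegree_mul (monic_shiftedCyclotomic hp u).ne_zero hne, hdeg, hdeg, pow_succ] at h
  rw [Nat.mul_sub_one]
  omega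

/-- The shifted cyclotomic polynomial is Eisenstein at `p`, with constant term exactly `p`. -/
theorem exists_shiftedCyclotomic_eq (hp : p.Prime) (u : ℕ) :
    ∃ B : ℤ[X], shiftedCyclotomic p u
      = X ^ (p ^ u * (p - 1)) + (p : ℤ[X]) * (1 + X * B) := by
  have hr : 0 < p ^ u := pow_pos hp.pos u
  have hp1 : 0 < p - 1 := Nat.sub_pos_of_lt hp.one_lt
  obtain ⟨g, hg⟩ := exists_shift_pow_sub_one_eq hp u
  set v : ℤ[X] := (X + 1) ^ p ^ u - 1 with hv
  have hv0 : v ≠ 0 := by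
    intro h
    have := natDegree_shift_pow (p ^ u)
    rw [sub_eq_zero.mp h, natDegree_one] at this
    omega
  obtain ⟨w, hw⟩ := exists_add_pow_prime_eq hp v 1
  have hΦ : shiftedCyclotomic p u = v ^ (p - 1) + p * w := by
    apply mul_right_cancel₀ hv0
    have h1 : (v + 1) ^ p = (X + 1) ^ p ^ (u + 1) := by
      rw [hv, sub_add_cancel, ← pow_mul, ← pow_succ]
    have h2 : v ^ p = v ^ (p - 1) * v := by rw [← pow_succ, Nat.sub_add_cancel hp.one_le]
    rw [shiftedCyclotomic_mul, ← h1, hw, h2]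
    ring
  obtain ⟨a, ha⟩ : (p : ℤ[X]) ∣ v ^ (p - 1) - (X ^ p ^ u) ^ (p - 1) :=
    dvd_trans ⟨g, by rw [hg]; ring⟩ (sub_dvd_pow_sub_pow _ _ _)
  have hc : shiftedCyclotomic p u = X ^ (p ^ u * (p - 1)) + (p : ℤ[X]) * (a + w) := by
    rw [hΦ, pow_mul, eq_add_of_sub_eq ha]
    ring
  have he : (a + w).coeff 0 = 1 := by
    have h := congrArg (eval 0) hc
    simp only [shiftedCyclotomic, eval_finsetSum, eval_add, eval_mul, eval_pow, eval_X, eval_one,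
      eval_natCast, zero_add, one_pow, Finset.sum_const, Finset.card_range, nsmul_eq_mul, mul_one,
      zero_pow (Nat.mul_pos hr hp1).ne'] at h
    rw [coeff_zero_eq_eval_zero, eval_add]
    have : (p : ℤ) ≠ 0 := by exact_mod_cast hp.ne_zero
    exact mul_left_cancel₀ this (by rw [← h, mul_one])
  refine ⟨(a + w).divX, ?_⟩
  have := X_mul_divX_add (a + w)
  rw [he, C_1] at this
  rw [add_comm 1, this, hc]

/-- Modulo `(X + 1) ^ (p ^ (u + 1)) - 1`, every block of `p ^ u * (p - 1)` factors `X` beyond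
the first `p ^ u` ones contributes a factor `p`. -/
theorem exists_X_pow_eq (hp : p.Prime) (u j : ℕ) :
    ∃ a b c : ℤ[X], X ^ (p ^ u * (j * (p - 1) + 1)) = ((X + 1) ^ p ^ (u + 1) - 1) * a
      + (p : ℤ[X]) ^ j * X ^ p ^ u * b + (p : ℤ[X]) ^ (j + 1) * c := by
  obtain ⟨g, hg⟩ := exists_shift_pow_sub_one_eq hp u
  set y : ℤ[X] := (X + 1) ^ p ^ u - 1 with hy
  set z : ℤ[X] := X ^ p ^ u with hz
  set w : ℤ[X] := (X + 1) ^ p ^ (u + 1) - 1 with hw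
  obtain ⟨m, hm⟩ : ∃ m, p = m + 2 := Nat.exists_eq_add_of_le' hp.two_le
  have hzp : ∃ b c, z ^ p = w + p * z * b + p ^ 2 * c := by
    obtain ⟨h, hh⟩ := exists_add_pow_prime_eq hp y 1
    obtain ⟨f, hf⟩ := exists_add_pow_prime_eq hp y (-(p * g))
    have h1 : (y + 1) ^ p = w + 1 := by
      rw [hy, hw, sub_add_cancel, sub_add_cancel, ← pow_mul, ← pow_succ]
    have h2 : z = y + -(p * g) := by rw [hg]; ring
    have h3 : y ^ p = w - p * y * h := by
      rw [h1, one_pow] at hh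
      linear_combination -hh
    have h4 : (-(p * g) : ℤ[X]) ^ p = p ^ 2 * ((-g) ^ 2 * (-(p * g)) ^ m) := by
      conv_lhs => rw [hm]
      rw [pow_add, ← hm]
      ring
    refine ⟨-h, -g * h + (-g) ^ 2 * (-(p * g)) ^ m - y * g * f, ?_⟩
    nth_rw 1 [h2]
    rw [hf, h3, h4, hg]
    ring
  obtain ⟨b₀, c₀, h₀⟩ := hzp
  induction j with
  | zero => exact ⟨0, 1, 0, by simp [hz]⟩
  | succ j ih =>
    obtain ⟨a, b, c, h⟩ := ih
    have hs : X ^ (p ^ u * ((j + 1) * (p - 1) + 1))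
        = X ^ (p ^ u * (j * (p - 1) + 1)) * z ^ (p - 1) := by
      rw [hz, ← pow_mul, ← pow_add]
      congr 1
      ring
    have h5 : z ^ p = z * z ^ (p - 1) := by rw [← pow_succ', Nat.sub_add_cancel hp.one_le]
    have h6 : z ^ (p - 1) = z * z ^ m := by rw [← pow_succ']; congr 1; omega
    refine ⟨a * z ^ (p - 1) + p ^ j * b, b₀ * b + z ^ m * c, c₀ * b, ?_⟩
    rw [hs, h]
    linear_combination (p ^ j * b : ℤ[X]) * h₀ - (p ^ j * b : ℤ[X]) * h5
      + (p ^ (j + 1) * c : ℤ[X]) * h6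

end PolynomialIdentities

section Functionals

variable {p : ℕ}

theorem map_natCast_pow_mul (L : ℤ[X] →ₗ[ℤ] ℤ) (m e : ℕ) (P : ℤ[X]) :
    L ((m : ℤ[X]) ^ e * P) = (m : ℤ) ^ e * L P := by
  have : (m : ℤ[X]) ^ e * P = ((m : ℤ) ^ e) • P := by
    rw [zsmul_eq_mul]
    push_cast
    rfl
  rw [this, map_zsmul, smul_eq_mul]

theorem map_natCast_mul (L : ℤ[X] →ₗ[ℤ] ℤ) (m : ℕ) (P : ℤ[X]) :
    L ((m : ℤ[X]) * P) = (m : ℤ) * L P := by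
  simpa using map_natCast_pow_mul L m 1 P

/-- Divisibility on the multiples of a monic polynomial and on a window of powers of `X` as long
as its degree extends to all multiples of the first power in the window. -/
theorem dvd_map_X_pow_mul (L : ℤ[X] →ₗ[ℤ] ℤ) {D : ℤ[X]} (hD : D.Monic) {N : ℤ} {a : ℕ}
    (hker : ∀ P, N ∣ L (X ^ a * (D * P)))
    (hwin : ∀ i < D.natDegree, N ∣ L (X ^ (a + i))) (P : ℤ[X]) : N ∣ L (X ^ a * P) := by
  rw [← modByMonic_add_div P D, mul_add, map_add]
  refine dvd_add ?_ (hker _)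
  by_cases h1 : D = 1
  · simp [h1]
  rw [as_sum_range' (P %ₘ D) D.natDegree (natDegree_modByMonic_lt P hD h1), Finset.mul_sum, map_sum]
  refine Finset.dvd_sum fun i hi => ?_
  have : X ^ a * monomial i ((P %ₘ D).coeff i) = (P %ₘ D).coeff i • (X ^ (a + i) : ℤ[X]) := by
    rw [← smul_X_eq_monomial, mul_smul_comm, pow_add]
  rw [this, map_zsmul, smul_eq_mul]
  exact (hwin i (Finset.mem_range.mp hi)).mul_left _

/-- A functional vanishing on the multiples of the shifted cyclotomic polynomial loses at most one
factor `p` when the power of `X` drops by `p ^ u * (p - 1)`. -/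
theorem dvd_map_of_dvd_map_add (hp : p.Prime) (u : ℕ) (K : ℤ[X] →ₗ[ℤ] ℤ)
    (hK : ∀ P, K (shiftedCyclotomic p u * P) = 0) {e a : ℕ}
    (h : ∀ P, (p : ℤ) ^ (e + 1) ∣ K (X ^ (a + p ^ u * (p - 1)) * P)) (P : ℤ[X]) :
    (p : ℤ) ^ e ∣ K (X ^ a * P) := by
  obtain ⟨B, hB⟩ := exists_shiftedCyclotomic_eq hp u
  set φ := p ^ u * (p - 1) with hφ
  have hp0 : (p : ℤ) ≠ 0 := by exact_mod_cast hp.ne_zero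
  have key : ∀ i ≤ φ, ∀ P, (p : ℤ) ^ e ∣ K (X ^ (a + φ - i) * P) := by
    intro i
    induction i with
    | zero => exact fun _ P => (pow_dvd_pow _ e.le_succ).trans (h P)
    | succ i ih =>
      intro hi P
      obtain ⟨b, hb⟩ : ∃ b, a + φ - i = b + 1 := ⟨a + φ - i - 1, by omega⟩
      have hb' : a + φ - (i + 1) = b := by omega
      have hbφ : b + φ = a + φ + (b - a) := by omega
      have hz := hK (X ^ b * P)
      have hsplit : shiftedCyclotomic p u * (X ^ b * P) = X ^ (a + φ) * (X ^ (b - a) * P)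
          + (p : ℤ[X]) * (X ^ (b + 1) * (B * P)) + (p : ℤ[X]) * (X ^ b * P) := by
        rw [hB, ← mul_assoc (X ^ (a + φ)), ← pow_add, ← hbφ]
        ring
      rw [hsplit, map_add, map_add, map_natCast_mul, map_natCast_mul] at hz
      rw [hb']
      have h1 := h (X ^ (b - a) * P)
      have h2 := ih (by omega) (B * P)
      rw [hb] at h2
      have h3 : (p : ℤ) ^ (e + 1) ∣ p * K (X ^ (b + 1) * (B * P)) := by
        rw [pow_succ']
        exact mul_dvd_mul_left _ h2
      have h4 : (p : ℤ) ^ (e + 1) ∣ p * K (X ^ b * P) :=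
        (dvd_add_right (dvd_add h1 h3)).mp (hz ▸ dvd_zero _)
      rw [pow_succ'] at h4
      exact (mul_dvd_mul_iff_left hp0).mp h4
  simpa using key φ le_rfl P

theorem dvd_map_of_dvd_map_add_mul (hp : p.Prime) (u : ℕ) (K : ℤ[X] →ₗ[ℤ] ℤ)
    (hK : ∀ P, K (shiftedCyclotomic p u * P) = 0) {e a : ℕ} (j : ℕ)
    (h : ∀ P, (p : ℤ) ^ (e + j) ∣ K (X ^ (a + j * (p ^ u * (p - 1))) * P)) (P : ℤ[X]) :
    (p : ℤ) ^ e ∣ K (X ^ a * P) := by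
  induction j with
  | zero => simpa using h P
  | succ j ih =>
    refine ih (dvd_map_of_dvd_map_add hp u K hK fun Q => ?_)
    have := h Q
    rwa [add_one_mul, ← add_assoc, ← add_assoc] at this

/-- A functional invariant under the shift by `p ^ u` is highly divisible on large powers of `X`. -/
theorem dvd_map_X_pow_of_periodic (hp : p.Prime) (u j : ℕ) (M : ℤ[X] →ₗ[ℤ] ℤ)
    (hM : ∀ P, M (((X + 1) ^ p ^ u - 1) * P) = 0) (P : ℤ[X]) :
    (p : ℤ) ^ (j + 3) ∣ M (X ^ (p ^ u + (j + 1) * (p ^ u * (p - 1))) * P) := by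
  cases u with
  | zero =>
    have : (X : ℤ[X]) ^ (p ^ 0 + (j + 1) * (p ^ 0 * (p - 1))) * P
        = ((X + 1) ^ p ^ 0 - 1) * (X ^ ((j + 1) * (p - 1)) * P) := by
      rw [pow_zero]
      ring
    rw [this, hM]
    exact dvd_zero _
  | succ s =>
    obtain ⟨a, b, c, h⟩ := exists_X_pow_eq hp s (j + 3)
    obtain ⟨m, rfl⟩ : ∃ m, p = m + 2 := Nat.exists_eq_add_of_le' hp.two_le
    have hle : (m + 2) ^ s * ((j + 3) * (m + 2 - 1) + 1)
        ≤ (m + 2) ^ (s + 1) + (j + 1) * ((m + 2) ^ (s + 1) * (m + 2 - 1)) := by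
      have : (m + 2) ^ (s + 1) + (j + 1) * ((m + 2) ^ (s + 1) * (m + 2 - 1))
          = (m + 2) ^ s * ((m + 2) * (1 + (j + 1) * (m + 1))) := by
        rw [Nat.add_sub_assoc (by norm_num)]
        ring
      rw [this]
      refine Nat.mul_le_mul_left _ ?_
      rw [Nat.add_sub_assoc (by norm_num)]
      nlinarith [Nat.zero_le (j * m), Nat.zero_le (j * m * m), Nat.zero_le (m * m)]
    obtain ⟨d, hd⟩ := Nat.exists_eq_add_of_le hle
    have hs : ∀ w x y z v Q : ℤ[X], (w * a + x * y * b + x * z * c) * v * Q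
        = w * (a * v * Q) + x * ((y * b + z * c) * v * Q) := by intros; ring
    rw [hd, pow_add X, h, pow_succ _ (j + 3), hs, map_add, hM, zero_add, map_natCast_pow_mul]
    exact dvd_mul_right _ _

/-- If a functional invariant under the shift by `p ^ (u + 1)` is divisible by `p ^ (j + 1)` on
`p ^ u * (p - 1)` consecutive powers of `X`, then modulo `p` it is invariant under the shift
by `p ^ u`. -/
theorem dvd_map_shift_sub_one_mul (hp : p.Prime) (u j : ℕ) (L : ℤ[X] →ₗ[ℤ] ℤ)
    (hL : ∀ P, L (((X + 1) ^ p ^ (u + 1) - 1) * P) = 0)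
    (hwin : ∀ i < p ^ u * (p - 1),
      (p : ℤ) ^ (j + 1) ∣ L (X ^ (p ^ u + j * (p ^ u * (p - 1)) + i))) (P : ℤ[X]) :
    (p : ℤ) ∣ L (((X + 1) ^ p ^ u - 1) * P) := by
  obtain ⟨g, hg⟩ := exists_shift_pow_sub_one_eq hp u
  have hmonic := monic_shiftedCyclotomic hp u
  have hdeg := natDegree_shiftedCyclotomic hp u
  have hmul := shiftedCyclotomic_mul p u
  set Φ := shiftedCyclotomic p u with hΦ
  set v : ℤ[X] := (X + 1) ^ p ^ u - 1 with hv
  cases j with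
  | zero =>
    simp only [zero_add, pow_one, zero_mul, add_zero] at hwin
    have h : ∀ P, (p : ℤ) ∣ L (X ^ p ^ u * P) := by
      refine dvd_map_X_pow_mul L hmonic (fun P => ?_) (by rwa [hdeg])
      have : X ^ p ^ u * (Φ * P) = ((X + 1) ^ p ^ (u + 1) - 1) * P - (p : ℤ[X]) * (g * (Φ * P)) := by
        rw [← hmul, hg]
        ring
      rw [this, map_sub, hL, map_natCast_mul, zero_sub, dvd_neg]
      exact dvd_mul_right _ _
    rw [hg, add_mul, map_add, mul_assoc, map_natCast_mul]
    exact dvd_add (h P) (dvd_mul_right _ _)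
  | succ j =>
    obtain ⟨a, ha⟩ : v ∣ Φ - p := by
      have : Φ - p = ∑ i ∈ Finset.range p, (((X + 1) ^ p ^ u) ^ i - 1) := by
        simp [hΦ, shiftedCyclotomic]
      rw [this]
      exact Finset.dvd_sum fun i _ => sub_one_dvd_pow_sub_one _ _
    let M : ℤ[X] →ₗ[ℤ] ℤ := L ∘ₗ LinearMap.mulLeft ℤ Φ
    let K : ℤ[X] →ₗ[ℤ] ℤ := L ∘ₗ LinearMap.mulLeft ℤ ((p : ℤ[X]) - Φ)
    have hMdef (P) : M P = L (Φ * P) := rfl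
    have hKdef (P) : K P = L (((p : ℤ[X]) - Φ) * P) := rfl
    have hM (P) : M (v * P) = 0 := by rw [hMdef, ← mul_assoc, hmul, hL]
    have hK (P) : K (Φ * P) = 0 := by
      have : ((p : ℤ[X]) - Φ) * (Φ * P) = ((X + 1) ^ p ^ (u + 1) - 1) * (-a * P) := by
        rw [← hmul]
        linear_combination -(Φ * P) * ha
      rw [hKdef, this, hL]
    have hKM (P) : K P = p * L P - M P := by
      rw [hKdef, hMdef, sub_mul, map_sub, map_natCast_mul]
    have htop : ∀ P, (p : ℤ) ^ (2 + (j + 1)) ∣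
        K (X ^ (p ^ u + (j + 1) * (p ^ u * (p - 1))) * P) := by
      refine dvd_map_X_pow_mul K hmonic (fun P => ?_) (fun i hi => ?_)
      · rw [mul_left_comm, hK]
        exact dvd_zero _
      · rw [hKM]
        refine dvd_sub ?_ ?_
        · rw [show 2 + (j + 1) = j + 1 + 1 + 1 by omega, pow_succ']
          exact mul_dvd_mul_left _ (hwin i (hdeg ▸ hi))
        · rw [pow_add X, show 2 + (j + 1) = j + 3 by omega]
          exact dvd_map_X_pow_of_periodic hp u j M hM _
    have h2 := dvd_map_of_dvd_map_add_mul hp u K hK (j + 1) htop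
    have hle : p ^ u ≤ p ^ u * (p - 1) :=
      Nat.le_mul_of_pos_right _ (Nat.sub_pos_of_lt hp.one_lt)
    have h1 : ∀ P, (p : ℤ) ^ 1 ∣ K (X ^ 0 * P) := by
      refine dvd_map_of_dvd_map_add hp u K hK fun P => ?_
      obtain ⟨d, hd⟩ := Nat.exists_eq_add_of_le hle
      rw [zero_add, hd, pow_add X, mul_assoc]
      exact h2 _
    have h3 : (p : ℤ) ^ 2 ∣ K (v * P) := by
      rw [hg, add_mul, map_add, mul_assoc, map_natCast_mul]
      refine dvd_add (h2 P) ?_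
      rw [pow_two]
      refine mul_dvd_mul_left _ ?_
      simpa using h1 (g * P)
    rw [hKM, hM, sub_zero, pow_two] at h3
    exact (mul_dvd_mul_iff_left (by exact_mod_cast hp.ne_zero)).mp h3

end Functionals

section Sequences

/-- The functional on `ℤ[X]` sending `(X + 1) ^ a` to `G a`. -/
noncomputable def sequenceFunctional (G : ℕ → ℤ) : ℤ[X] →ₗ[ℤ] ℤ :=
  Polynomial.lsum (fun a => LinearMap.mulRight ℤ (G a)) ∘ₗ taylor (-1)

theorem sequenceFunctional_shift_pow (G : ℕ → ℤ) (a : ℕ) :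
    sequenceFunctional G ((X + 1) ^ a) = G a := by
  have : taylor (-1) ((X + 1 : ℤ[X]) ^ a) = X ^ a := by
    rw [taylor_pow, map_add, taylor_X, taylor_one]
    simp
  rw [sequenceFunctional, LinearMap.comp_apply, this]
  rw [Polynomial.lsum_apply, ← monomial_one_right_eq_X_pow, sum_monomial_index _ _ (by simp)]
  simp

theorem sequenceFunctional_X_pow (G : ℕ → ℤ) (d : ℕ) :
    sequenceFunctional G (X ^ d)
      = ∑ i ∈ Finset.range (d + 1), d.choose i • ((-1) ^ (d - i) * G i) := by
  have : (X : ℤ[X]) ^ d = ∑ i ∈ Finset.range (d + 1),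
      ((d.choose i : ℤ) * (-1) ^ (d - i)) • (X + 1) ^ i := by
    conv_lhs => rw [show (X : ℤ[X]) = (X + 1) + -1 by ring, add_pow]
    refine Finset.sum_congr rfl fun i _ => ?_
    rw [zsmul_eq_mul]
    push_cast
    ring
  rw [this, map_sum]
  refine Finset.sum_congr rfl fun i _ => ?_
  rw [map_zsmul, sequenceFunctional_shift_pow, smul_eq_mul, nsmul_eq_mul, mul_assoc]

theorem sequenceFunctional_shift_sub_one_mul {G : ℕ → ℤ} {q : ℕ} (hG : G.Periodic q) (P : ℤ[X]) :
    sequenceFunctional G (((X + 1) ^ q - 1) * P) = 0 := by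
  have hP : P = ∑ i ∈ Finset.range ((taylor (-1) P).natDegree + 1),
      (taylor (-1) P).coeff i • (X + 1 : ℤ[X]) ^ i := by
    conv_lhs => rw [← sum_taylor_eq P (-1)]
    rw [Polynomial.sum_over_range _ (by simp)]
    refine Finset.sum_congr rfl fun i _ => ?_
    simp [smul_eq_C_mul]
  rw [hP, Finset.mul_sum, map_sum]
  refine Finset.sum_eq_zero fun i _ => ?_
  rw [mul_smul_comm, map_zsmul, sub_mul, one_mul, ← pow_add, map_sub,
    sequenceFunctional_shift_pow, sequenceFunctional_shift_pow, add_comm q, hG, sub_self, smul_zero]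

/-- A `0`-`1` sequence of period `p ^ (u + 1)` whose iterated differences at `0` are divisible by
`p ^ (j + 1)` on a suitable window has period `p ^ u`. -/
theorem periodic_of_dvd_differences {p : ℕ} (hp : p.Prime) (u j : ℕ) {G : ℕ → ℤ}
    (hG : G.Periodic (p ^ (u + 1))) (h01 : ∀ a, G a = 0 ∨ G a = 1)
    (hwin : ∀ i < p ^ u * (p - 1), (p : ℤ) ^ (j + 1) ∣
      sequenceFunctional G (X ^ (p ^ u + j * (p ^ u * (p - 1)) + i))) :
    G.Periodic (p ^ u) := by
  intro a
  have h := dvd_map_shift_sub_one_mul hp u j (sequenceFunctional G)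
    (sequenceFunctional_shift_sub_one_mul hG) hwin ((X + 1) ^ a)
  rw [sub_mul, one_mul, ← pow_add, map_sub, sequenceFunctional_shift_pow,
    sequenceFunctional_shift_pow, add_comm (p ^ u)] at h
  have hp2 : (2 : ℤ) ≤ p := by exact_mod_cast hp.two_le
  rw [← sub_eq_zero]
  refine Int.eq_zero_of_abs_lt_dvd h ?_
  rw [abs_lt]
  rcases h01 a with h1 | h1 <;> rcases h01 (a + p ^ u) with h2 | h2 <;> rw [h1, h2] <;> omega

end Sequences

section BooleanFunctions

variable {n : ℕ}

/-- The value of `f` at the input with ones exactly in the first `a` coordinates. -/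
def weightValue (f : (Fin n → Bool) → Bool) (a : ℕ) : ℤ :=
  if f (fun i => decide (i.val < a)) then 1 else 0

theorem wt_decide_mem (T : Finset (Fin n)) : wt (fun i => decide (i ∈ T)) = T.card := by
  simp [wt]

theorem wt_decide_lt {a : ℕ} (ha : a ≤ n) : wt (fun i : Fin n => decide (i.val < a)) = a := by
  simp [wt, Fin.card_filter_val_lt, ha]

theorem wt_le (x : Fin n → Bool) : wt x ≤ n := by
  simpa [wt] using Finset.card_le_univ (Finset.univ.filter fun i => x i = true)

theorem weightValue_wt {f : (Fin n → Bool) → Bool} (hsym : SymmetricBF f) (x : Fin n → Bool) :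
    weightValue f (wt x) = if f x then 1 else 0 := by
  rw [weightValue, hsym _ x (wt_decide_lt (wt_le x))]

theorem weightValue_eq_of_mod_eq {f : (Fin n → Bool) → Bool} {q a b : ℕ} (hper : PeriodicBF q f)
    (ha : a ≤ n) (hb : b ≤ n) (h : a % q = b % q) : weightValue f a = weightValue f b := by
  have := hper (fun i => decide (i.val < a)) (fun i => decide (i.val < b))
    (by rwa [wt_decide_lt ha, wt_decide_lt hb])
  rw [weightValue, weightValue, this]

/-- Coefficients of a symmetric function are iterated differences of its univariate version. -/
theorem modCoeff_eq_sequenceFunctional {f : (Fin n → Bool) → Bool} (hsym : SymmetricBF f) (m : ℕ)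
    {G : ℕ → ℤ} (hG : ∀ a ≤ n, G a = weightValue f a) (S : Finset (Fin n)) :
    modCoeff m n f S = (sequenceFunctional G (X ^ S.card) : ℤ) := by
  rw [sequenceFunctional_X_pow,
    ← Finset.sum_powerset_apply_card (fun i => (-1) ^ (S.card - i) * G i), modCoeff, Int.cast_sum]
  refine Finset.sum_congr rfl fun T _ => ?_
  have hT : T.card ≤ n := by simpa using Finset.card_le_univ T
  have hv := weightValue_wt hsym (fun i => decide (i ∈ T))
  rw [wt_decide_mem] at hv
  rw [hG _ hT, hv]
  push_cast
  rfl

theorem modCoeff_eq_zero_of_modDeg_lt {m : ℕ} {f : (Fin n → Bool) → Bool} {S : Finset (Fin n)}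
    (h : modDeg m n f < S.card) : modCoeff m n f S = 0 := by
  by_contra hS
  exact h.not_ge (Finset.le_sup (f := Finset.card) (by simpa using hS))

end BooleanFunctions

/-- If the base-`p` period of a symmetric Boolean function equals `p^t`
(`t ≥ 1`) and `n ≥ (k−1)φ(p^t) + p^t − 1`, then `deg_{p^k}(f) ≥ (k−2)φ(p^t) + p^t`. -/
theorem stmt6 (p t k n : ℕ) (hp : p.Prime) (ht : 1 ≤ t) (hk : 0 < k)
    (f : (Fin n → Bool) → Bool) (hsym : SymmetricBF f)
    (hper : PeriodicBF (p ^ t) f) (hnper : ¬ PeriodicBF (p ^ (t - 1)) f)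
    (hn : (k - 1) * Nat.totient (p ^ t) + p ^ t - 1 ≤ n) :
    ((k : ℤ) - 2) * (Nat.totient (p ^ t) : ℤ) + (p : ℤ) ^ t ≤ (modDeg (p ^ k) n f : ℤ) := by
  obtain ⟨u, rfl⟩ : ∃ u, t = u + 1 := Nat.exists_eq_add_of_le' ht
  obtain ⟨j, rfl⟩ : ∃ j, k = j + 1 := Nat.exists_eq_add_of_le' hk
  have hφ : Nat.totient (p ^ (u + 1)) = p ^ u * (p - 1) := Nat.totient_prime_pow_succ hp u
  have hq : p ^ (u + 1) = p ^ u + p ^ u * (p - 1) := by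
    rw [add_comm (p ^ u), ← mul_add_one, Nat.sub_add_cancel hp.one_le, pow_succ]
  have hq0 : 0 < p ^ (u + 1) := pow_pos hp.pos _
  rw [hφ, Nat.add_sub_cancel] at hn
  rw [hφ, ← Nat.cast_pow]
  rw [Nat.add_sub_cancel] at hnper
  set φ := p ^ u * (p - 1) with hφdef
  by_contra hlt
  have hdeg : modDeg (p ^ (j + 1)) n f < p ^ u + j * φ := by
    zify
    rw [hq] at hlt
    push_cast at hlt
    linarith
  set G : ℕ → ℤ := fun a => weightValue f (a % p ^ (u + 1)) with hGdef
  have hmod (a : ℕ) : a % p ^ (u + 1) ≤ n := by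
    have := Nat.mod_lt a hq0
    omega
  have hG : ∀ a ≤ n, G a = weightValue f a := fun a ha =>
    weightValue_eq_of_mod_eq hper (hmod a) ha (Nat.mod_mod _ _)
  have hGper : G.Periodic (p ^ u) := by
    refine periodic_of_dvd_differences hp u j (fun a => by simp [hGdef]) (fun a => ?_)
      (fun i hi => ?_)
    · simp only [hGdef, weightValue]
      split_ifs <;> simp
    · obtain ⟨S, -, hS⟩ := Finset.exists_subset_card_eq
        (s := (Finset.univ : Finset (Fin n))) (n := p ^ u + j * φ + i)
        (by rw [Finset.card_fin]; omega)
      have h0 := modCoeff_eq_zero_of_modDeg_lt (S := S) (hdeg.trans_le (by omega))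
      rw [modCoeff_eq_sequenceFunctional hsym _ hG, ZMod.intCast_zmod_eq_zero_iff_dvd, hS] at h0
      exact_mod_cast h0
  refine hnper fun x y hxy => ?_
  have hx := weightValue_wt hsym x
  have hy := weightValue_wt hsym y
  rw [← hG _ (wt_le x), ← hGper.map_mod_nat] at hx
  rw [← hG _ (wt_le y), ← hGper.map_mod_nat, ← hxy, hx] at hy
  cases hfx : f x <;> cases hfy : f y <;> simp_all
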